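/- Let τ = {τ_i=(e_i,d_i,p_i): 1 ≤ i ≤ n} be constrained-deadline tasks with positive rational parameters satisfying: dbf(τ,t) ≤ t for all t > 0; d_i + p_i > d_n for all 1 ≤ i ≤ n−1; and d_i = e_i + d_{i−1} for all 1 ≤ i ≤ n (with d_0 := 0). Then there exist a positive integer n' and a set τ' = {τ'_l=(e'_l,d'_l,p'_l): 1 ≤ l ≤ n'} of constrained-deadline tasks with positive rational parameters such that: e'_l = d_n/n' and d'_l = l·(d_n/n') for all 1 ≤ l ≤ n' (so the largest deadline of τ' equals d_n); dbf(τ',t) ≤ t for all t > 0; d'_l + p'_l > d_n for all 1 ≤ l ≤ n'−1; and dbf*(τ', d_n) ≥ dbf*(τ, d_n). -/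

import Mathlib

open Finset

/-- Demand bound function of a task `(e, d, p)` at time `t`. -/
noncomputable def dbf (e d p t : ℝ) : ℝ :=
  if t < d then 0 else ((⌊(t - d) / p⌋ : ℝ) + 1) * e

/-- Approximate demand bound function of a task `(e, d, p)` at time `t`. -/
noncomputable def dbfStar (e d p t : ℝ) : ℝ :=
  if t < d then 0 else ((t - d) / p + 1) * e

/-- Modified demand function `f` of a task `(e, d, p)` at time `t`. -/
noncomputable def fmod (e d p t : ℝ) : ℝ :=
  if t < d + p then dbf e d p t else 2 * e

/-- Finitely many nonnegative rationals have a common positive denominator. -/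
lemma exists_common_den (s : Finset ℕ) (x : ℕ → ℚ) (hx : ∀ i ∈ s, 0 ≤ x i) :
    ∃ N : ℕ, 0 < N ∧ ∃ k : ℕ → ℕ, ∀ i ∈ s, (k i : ℚ) = x i * N := by
  refine ⟨∏ i ∈ s, (x i).den, Finset.prod_pos fun i _ => (x i).den_pos,
    fun i => (x i).num.toNat * ∏ j ∈ s.erase i, (x j).den, fun i hi => ?_⟩
  have hnum : (((x i).num.toNat : ℕ) : ℚ) = (x i).num := by
    exact_mod_cast Int.toNat_of_nonneg (Rat.num_nonneg.mpr (hx i hi))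
  rw [← Finset.mul_prod_erase s _ hi]
  push_cast
  rw [hnum, ← mul_assoc, Rat.mul_den_eq_num]

lemma sum_Icc_eq_sum_blocks {M : Type*} [AddCommMonoid M] {m : ℕ → ℕ} (hm : Monotone m)
    (h0 : m 0 = 0) (F : ℕ → M) (n : ℕ) :
    ∑ l ∈ Finset.Icc 1 (m n), F l =
      ∑ i ∈ Finset.Icc 1 n, ∑ l ∈ Finset.Ioc (m (i - 1)) (m i), F l := by
  induction n with
  | zero => simp [h0]
  | succ n ih =>
    rw [Finset.sum_Icc_succ_top (by omega), ← ih, Nat.add_sub_cancel]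
    exact (Finset.sum_Ioc_consecutive F (Nat.zero_le _) (hm n.le_succ)).symm

/-- The index of the block of the partition `m 0 ≤ m 1 ≤ …` that contains `l`. -/
noncomputable def blockIndex (m : ℕ → ℕ) (l : ℕ) : ℕ := sInf {i | l ≤ m i}

lemma blockIndex_eq {m : ℕ → ℕ} (hm : Monotone m) {i l : ℕ}
    (h₁ : m (i - 1) < l) (h₂ : l ≤ m i) : blockIndex m l = i := by
  refine le_antisymm (Nat.sInf_le h₂) ?_
  by_contra! h
  have h₃ : l ≤ m (blockIndex m l) := Nat.sInf_mem (s := {i | l ≤ m i}) ⟨i, h₂⟩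
  have h₄ : m (blockIndex m l) ≤ m (i - 1) := hm (by omega)
  omega

lemma blockIndex_mem {m : ℕ → ℕ} (h0 : m 0 = 0) {n l : ℕ}
    (hl : l ∈ Finset.Icc 1 (m n)) :
    blockIndex m l ∈ Finset.Icc 1 n ∧ l ≤ m (blockIndex m l) := by
  rw [Finset.mem_Icc] at hl
  have h₃ : l ≤ m (blockIndex m l) := Nat.sInf_mem (s := {i | l ≤ m i}) ⟨n, hl.2⟩
  refine ⟨Finset.mem_Icc.mpr ⟨?_, Nat.sInf_le hl.2⟩, h₃⟩
  by_contra! h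
  have h₄ : blockIndex m l = 0 := by omega
  rw [h₄, h0] at h₃
  omega

/-- Moving the first deadline earlier while keeping the second one does not increase the demand
after the original first deadline. -/
lemma dbf_le_dbf_of_le_deadline {e x P y p t : ℝ} (he : 0 ≤ e) (hxy : x ≤ y) (hyt : y ≤ t)
    (hq : x + P = y + p) (hp : 0 < p) : dbf e x P t ≤ dbf e y p t := by
  have hpP : p ≤ P := by linarith
  have hP : 0 < P := hp.trans_le hpP
  rw [dbf, dbf, if_neg (by linarith), if_neg (by linarith)]
  refine mul_le_mul_of_nonneg_right (add_le_add_left (Int.cast_le.mpr ?_) 1) he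
  rcases lt_or_ge t (y + p) with h | h
  · have h₁ : ⌊(t - x) / P⌋ < 1 := by
      rw [Int.floor_lt, Int.cast_one, div_lt_one hP]
      linarith
    have h₂ : 0 ≤ ⌊(t - y) / p⌋ := Int.floor_nonneg.mpr (div_nonneg (by linarith) hp.le)
    omega
  · refine Int.floor_le_floor ?_
    have h₁ : (t - x) / P = (t - (y + p)) / P + 1 := by
      rw [← hq]; field_simp; ring
    have h₂ : (t - y) / p = (t - (y + p)) / p + 1 := by field_simp; ring
    have h₃ : (t - (y + p)) / P ≤ (t - (y + p)) / p :=
      div_le_div_of_nonneg_left (by linarith) hp hpP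
    linarith

/-- Moving the first deadline earlier while keeping the second one does not decrease the
approximate demand before the second deadline. -/
lemma dbfStar_le_dbfStar_of_le_deadline {e x P y p t : ℝ} (he : 0 ≤ e) (hxy : x ≤ y)
    (hyt : y ≤ t) (hq : x + P = y + p) (hp : 0 < p) (ht : t ≤ y + p) :
    dbfStar e y p t ≤ dbfStar e x P t := by
  have hpP : p ≤ P := by linarith
  have hP : 0 < P := hp.trans_le hpP
  rw [dbfStar, dbfStar, if_neg (by linarith), if_neg (by linarith)]
  refine mul_le_mul_of_nonneg_right (add_le_add_left ?_ 1) he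
  have h₁ : (t - x) / P = 1 - (y + p - t) / P := by
    rw [← hq]; field_simp; ring
  have h₂ : (t - y) / p = 1 - (y + p - t) / p := by field_simp; ring
  have h₃ : (y + p - t) / P ≤ (y + p - t) / p :=
    div_le_div_of_nonneg_left (by linarith) hp hpP
  linarith

lemma dbf_eq_ite_of_lt {e d p t : ℝ} (hp : 0 < p) (ht : t < d + p) :
    dbf e d p t = if t < d then 0 else e := by
  unfold dbf
  split_ifs with h
  · rfl
  · have : ⌊(t - d) / p⌋ = 0 := by
      rw [Int.floor_eq_zero_iff]
      exact ⟨div_nonneg (by linarith) hp.le, (div_lt_one hp).mpr (by linarith)⟩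
    simp [this]

lemma dbf_mul (k e d p t : ℝ) : dbf (k * e) d p t = k * dbf e d p t := by
  unfold dbf
  split_ifs <;> ring

lemma dbfStar_mul (k e d p t : ℝ) : dbfStar (k * e) d p t = k * dbfStar e d p t := by
  unfold dbfStar
  split_ifs <;> ring

lemma sum_ite_mul_le {ε t : ℝ} (hε : 0 < ε) (ht : 0 ≤ t) (N : ℕ) :
    ∑ l ∈ Finset.Icc 1 N, (if t < (l : ℝ) * ε then 0 else ε) ≤ t := by
  have hsub : (Finset.Icc 1 N).filter (fun l : ℕ => ¬ t < (l : ℝ) * ε) ⊆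
      Finset.Icc 1 ⌊t / ε⌋₊ := by
    intro l hl
    rw [Finset.mem_filter, Finset.mem_Icc, not_lt] at hl
    exact Finset.mem_Icc.mpr ⟨hl.1.1, Nat.le_floor ((le_div_iff₀ hε).mpr hl.2)⟩
  have hcard := Finset.card_le_card hsub
  rw [Nat.card_Icc, Nat.add_sub_cancel] at hcard
  rw [Finset.sum_ite, Finset.sum_const_zero, zero_add, Finset.sum_const, nsmul_eq_mul,
    ← le_div_iff₀ hε]
  exact (Nat.cast_le.mpr hcard).trans (Nat.floor_le (div_nonneg ht hε.le))

/-- Given feasible constrained-deadline tasks with positive rational parameters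
satisfying `dbf(τ,t) ≤ t`, `d_i + p_i > d_n` for `i ≤ n−1`, and `d_i = e_i + d_{i−1}`
(`d_0 := 0`), there exist `n' ≥ 1` and a feasible constrained-deadline task set `τ'` of `n'`
tasks with `e'_l = d_n/n'`, `d'_l = l·(d_n/n')`, `d'_l + p'_l > d_n` for `l ≤ n'−1`, and
`dbf*(τ', d_n) ≥ dbf*(τ, d_n)`. -/
theorem stmt9 (n : ℕ) (hn : 0 < n) (e d p : ℕ → ℚ) (hd0 : d 0 = 0)
    (hpos : ∀ i ∈ Finset.Icc 1 n, 0 < e i ∧ 0 < d i ∧ 0 < p i)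
    (hcd : ∀ i ∈ Finset.Icc 1 n, d i ≤ p i)
    (hdbf : ∀ t : ℝ, 0 < t →
      ∑ i ∈ Finset.Icc 1 n, dbf ((e i : ℝ)) ((d i : ℝ)) ((p i : ℝ)) t ≤ t)
    (hdp : ∀ i ∈ Finset.Icc 1 (n - 1), d i + p i > d n)
    (hstep : ∀ i ∈ Finset.Icc 1 n, d i = e i + d (i - 1)) :
    ∃ n' : ℕ, 0 < n' ∧ ∃ p' : ℕ → ℚ,
      (∀ l ∈ Finset.Icc 1 n', 0 < p' l) ∧
      (∀ l ∈ Finset.Icc 1 n', (l : ℚ) * (d n / (n' : ℚ)) ≤ p' l) ∧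
      (∀ t : ℝ, 0 < t →
        ∑ l ∈ Finset.Icc 1 n',
          dbf ((d n / (n' : ℚ) : ℚ) : ℝ) (((l : ℚ) * (d n / (n' : ℚ)) : ℚ) : ℝ)
            ((p' l : ℝ)) t ≤ t) ∧
      (∀ l ∈ Finset.Icc 1 (n' - 1), (l : ℚ) * (d n / (n' : ℚ)) + p' l > d n) ∧
      ∑ l ∈ Finset.Icc 1 n',
          dbfStar ((d n / (n' : ℚ) : ℚ) : ℝ) (((l : ℚ) * (d n / (n' : ℚ)) : ℚ) : ℝ)
            ((p' l : ℝ)) ((d n : ℝ)) ≥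
        ∑ i ∈ Finset.Icc 1 n, dbfStar ((e i : ℝ)) ((d i : ℝ)) ((p i : ℝ)) ((d n : ℝ)) := by
  have hDpos : 0 < d n := (hpos n (Finset.mem_Icc.mpr ⟨hn, le_rfl⟩)).2.1
  obtain ⟨N, hN, k, hk⟩ := exists_common_den (Finset.Icc 1 n) (fun i => e i / d n)
    fun i hi => div_nonneg (hpos i hi).1.le hDpos.le
  have hNQ : (0 : ℚ) < N := Nat.cast_pos.mpr hN
  obtain ⟨ε, hε⟩ : ∃ ε, ε = d n / (N : ℚ) := ⟨_, rfl⟩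
  have hεpos : 0 < ε := hε ▸ div_pos hDpos hNQ
  have he : ∀ i ∈ Finset.Icc 1 n, e i = k i * ε := by
    intro i hi
    rw [hk i hi, hε]
    field_simp
  obtain ⟨m, hm⟩ : ∃ m : ℕ → ℕ, m = fun i => ∑ j ∈ Finset.range i, k (j + 1) := ⟨_, rfl⟩
  have hm0 : m 0 = 0 := by simp [hm]
  have hmsucc : ∀ i, m (i + 1) = m i + k (i + 1) := fun i => by
    simp [hm, Finset.sum_range_succ]
  have hmono : Monotone m := monotone_nat_of_le_succ fun i => by rw [hmsucc]; omega
  have hd : ∀ i ≤ n, d i = m i * ε := by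
    intro i
    induction i with
    | zero => simp [hd0, hm0]
    | succ i ih =>
      intro hi
      have hmem : i + 1 ∈ Finset.Icc 1 n := Finset.mem_Icc.mpr ⟨by omega, hi⟩
      rw [hstep _ hmem, Nat.add_sub_cancel, ih (by omega), he _ hmem, hmsucc]
      push_cast
      ring
  have hmn : m n = N := by
    have h₁ : (m n : ℚ) * ε = N * ε := by
      rw [← hd n le_rfl, hε]
      field_simp
    exact_mod_cast mul_right_cancel₀ hεpos.ne' h₁
  have hdle : ∀ i ∈ Finset.Icc 1 n, d i ≤ d n := by
    intro i hi
    have hin := (Finset.mem_Icc.mp hi).2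
    rw [hd i hin, hd n le_rfl]
    exact mul_le_mul_of_nonneg_right (Nat.cast_le.mpr (hmono hin)) hεpos.le
  have hq : ∀ i ∈ Finset.Icc 1 n, d n < d i + p i := by
    intro i hi
    rcases eq_or_ne i n with rfl | hne
    · linarith [(hpos i hi).2.2]
    · rw [Finset.mem_Icc] at hi
      exact hdp i (Finset.mem_Icc.mpr ⟨hi.1, by omega⟩)
  obtain ⟨p', hp'⟩ : ∃ p' : ℕ → ℚ, p' = fun l =>
    d (blockIndex m l) + p (blockIndex m l) - l * ε := ⟨_, rfl⟩
  have hblock : ∀ l ∈ Finset.Icc 1 N, (l : ℚ) * ε ≤ p' l ∧ d n < l * ε + p' l := by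
    intro l hl
    obtain ⟨hi, hli⟩ := blockIndex_mem hm0 (hmn.symm ▸ hl)
    have h₁ : (l : ℚ) * ε ≤ d (blockIndex m l) := by
      rw [hd _ (Finset.mem_Icc.mp hi).2]
      exact mul_le_mul_of_nonneg_right (Nat.cast_le.mpr hli) hεpos.le
    have h₂ := hcd _ hi
    have h₃ := hq _ hi
    simp only [hp']
    constructor <;> linarith
  have hp'pos : ∀ l ∈ Finset.Icc 1 N, 0 < p' l := fun l hl =>
    (mul_pos (Nat.cast_pos.mpr (Finset.mem_Icc.mp hl).1) hεpos).trans_le (hblock l hl).1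
  have hmemblock : ∀ i ∈ Finset.Icc 1 n, ∀ l ∈ Finset.Ioc (m (i - 1)) (m i),
      (((l : ℚ) * ε : ℚ) : ℝ) ≤ d i ∧ (((l : ℚ) * ε : ℚ) : ℝ) + p' l = d i + p i := by
    intro i hi l hl
    rw [Finset.mem_Ioc] at hl
    have h₁ : (l : ℚ) * ε ≤ d i := by
      rw [hd _ (Finset.mem_Icc.mp hi).2]
      exact mul_le_mul_of_nonneg_right (Nat.cast_le.mpr hl.2) hεpos.le
    have h₂ : (l : ℚ) * ε + p' l = d i + p i := by
      simp only [hp', blockIndex_eq hmono hl.1 hl.2]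
      ring
    exact ⟨by exact_mod_cast h₁, by exact_mod_cast h₂⟩
  have hcard : ∀ i ∈ Finset.Icc 1 n, (Finset.Ioc (m (i - 1)) (m i)).card = k i := by
    intro i hi
    have h₁ := hmsucc (i - 1)
    rw [Nat.sub_add_cancel (Finset.mem_Icc.mp hi).1] at h₁
    rw [Nat.card_Ioc, h₁, Nat.add_sub_cancel_left]
  have heR : ∀ i ∈ Finset.Icc 1 n, (e i : ℝ) = k i * (ε : ℝ) := fun i hi => by
    exact_mod_cast congrArg (Rat.cast : ℚ → ℝ) (he i hi)
  have hεR : (0 : ℝ) < ε := Rat.cast_pos.mpr hεpos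
  have hpR : ∀ i ∈ Finset.Icc 1 n, (0 : ℝ) < p i := fun i hi =>
    Rat.cast_pos.mpr (hpos i hi).2.2
  have hdleR : ∀ i ∈ Finset.Icc 1 n, (d i : ℝ) ≤ d n := fun i hi =>
    Rat.cast_le.mpr (hdle i hi)
  refine ⟨N, hN, p', hp'pos, ?_⟩
  rw [← hε]
  refine ⟨fun l hl => (hblock l hl).1, fun t ht => ?_, fun l hl => (hblock l ?_).2, ?_⟩
  · rcases lt_or_ge t (d n : ℝ) with htd | htd
    · refine le_trans (le_of_eq (Finset.sum_congr rfl fun l hl => ?_)) (sum_ite_mul_le hεR ht.le N)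
      have h₁ : (d n : ℝ) < (((l : ℚ) * ε : ℚ) : ℝ) + p' l := by
        exact_mod_cast (hblock l hl).2
      rw [dbf_eq_ite_of_lt (Rat.cast_pos.mpr (hp'pos l hl)) (htd.trans h₁)]
      push_cast
      rfl
    · refine le_trans ?_ (hdbf t ht)
      rw [← hmn, sum_Icc_eq_sum_blocks hmono hm0]
      refine Finset.sum_le_sum fun i hi => ?_
      rw [heR i hi, dbf_mul, ← hcard i hi, ← nsmul_eq_mul]
      refine Finset.sum_le_card_nsmul _ _ _ fun l hl => ?_
      obtain ⟨h₁, h₂⟩ := hmemblock i hi l hl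
      exact dbf_le_dbf_of_le_deadline hεR.le h₁ ((hdleR i hi).trans htd) h₂ (hpR i hi)
  · rw [Finset.mem_Icc] at hl ⊢
    omega
  · rw [ge_iff_le, ← hmn, sum_Icc_eq_sum_blocks hmono hm0]
    refine Finset.sum_le_sum fun i hi => ?_
    rw [heR i hi, dbfStar_mul, ← hcard i hi, ← nsmul_eq_mul]
    refine Finset.card_nsmul_le_sum _ _ _ fun l hl => ?_
    obtain ⟨h₁, h₂⟩ := hmemblock i hi l hl
    have h₃ : (d n : ℝ) < d i + p i := by exact_mod_cast hq i hi
    exact dbfStar_le_dbfStar_of_le_deadline hεR.le h₁ (hdleR i hi) h₂ (hpR i hi) h₃.le
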